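/- Let X be a Polish space, {Pθ}_{θ∈Θ} a family of Borel probability measures on X indexed by a nonempty type Θ, and P0 a Borel probability measure on X. Let D be a metric on the space P(X) of Borel probability measures such that, for every P ∈ P(X) and ε > 0, the ball { Q ∈ P(X) : D(Q, P) ≤ ε } is convex and is closed with respect to the total variation distance. Suppose ε > ε_{P0} := inf_{θ∈Θ} D(P0, Pθ). Define I_ε(θ) = min { KL(Q | Pθ) : Q ∈ P(X), D(Q, P0) ≤ ε }. Then inf_{θ∈Θ} I_ε(θ) = 0, and { θ ∈ Θ : I_ε(θ) = 0 } = { θ ∈ Θ : D(P0, Pθ) ≤ ε }; in other words, the set of global minimizers of θ ↦ I_ε(θ) equals the set of identifiable parameters Θ_ε(P0) = { θ : D(P0, Pθ) ≤ ε }. -/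

import Mathlib

open MeasureTheory ENNReal Filter Topology
open scoped Classical

/-- Total variation distance between measures: `tv(P, Q) = sup_A |P(A) − Q(A)|` over
measurable sets `A`. -/
noncomputable def tvMeas {X : Type*} [MeasurableSpace X] (P Q : Measure X) : ℝ :=
  ⨆ A : {s : Set X // MeasurableSet s}, |(P A).toReal - (Q A).toReal|

/-- Kullback–Leibler divergence `KL(Q|P) = ∫ log (dQ/dP) dQ` if `Q ≪ P` (and the integral
exists), and `∞` otherwise. -/
noncomputable def KLdiv {X : Type*} [MeasurableSpace X] (Q P : Measure X) : ℝ≥0∞ :=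
  if Q ≪ P ∧ Integrable (fun x => Real.log (Q.rnDeriv P x).toReal) Q
  then ENNReal.ofReal (∫ x, Real.log (Q.rnDeriv P x).toReal ∂Q) else ⊤

/-- OKL with respect to a real-valued discrepancy `D`. -/
noncomputable def OKLD {X : Type*} [MeasurableSpace X]
    (D : Measure X → Measure X → ℝ) (P0 Pθ : Measure X) (ε : ℝ) : ℝ≥0∞ :=
  ⨅ Q ∈ {Q : Measure X | IsProbabilityMeasure Q ∧ D Q P0 ≤ ε}, KLdiv Q Pθ

open InformationTheory in
/-- The Fenchel–Young inequality for `klFun`. -/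
lemma mul_sub_one_le_klFun_add_exp {x : ℝ} (hx : 0 ≤ x) (s : ℝ) :
    s * (x - 1) ≤ klFun x + (Real.exp s - 1 - s) := by
  rw [klFun_apply]
  rcases hx.eq_or_lt with rfl | hx
  · simp only [zero_mul]
    linarith [Real.exp_pos s]
  · have h1 : Real.exp s = x * Real.exp (s - Real.log x) := by
      rw [Real.exp_sub, Real.exp_log hx]
      field_simp
    have h2 := mul_le_mul_of_nonneg_left (Real.add_one_le_exp (s - Real.log x)) hx.le
    nlinarith

open InformationTheory in
lemma mul_abs_sub_one_le_klFun_add_sq {x s : ℝ} (hx : 0 ≤ x) (hs : 0 ≤ s) (hs1 : s ≤ 1) :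
    s * |x - 1| ≤ klFun x + s ^ 2 := by
  have h1 := mul_sub_one_le_klFun_add_exp hx s
  have h2 := mul_sub_one_le_klFun_add_exp hx (-s)
  have h3 := (abs_le.1 (Real.abs_exp_sub_one_sub_id_le (abs_le.2 ⟨by linarith, hs1⟩))).2
  have h4 := (abs_le.1 (Real.abs_exp_sub_one_sub_id_le
    (abs_le.2 ⟨neg_le_neg hs1, by linarith⟩ : |(-s)| ≤ 1))).2
  rcases abs_cases (x - 1) with h | h <;> rw [h.1] <;> nlinarith

lemma KLdiv_eq_klDiv {X : Type*} [MeasurableSpace X] (Q P : Measure X)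
    [IsProbabilityMeasure Q] [IsProbabilityMeasure P] :
    KLdiv Q P = InformationTheory.klDiv Q P := by
  rw [KLdiv, InformationTheory.klDiv_def]
  simp [llr_def]

open InformationTheory in
/-- A Pinsker-type bound: small Kullback–Leibler divergence forces small total variation. -/
lemma tvMeas_le_of_klDiv_le {X : Type*} [MeasurableSpace X] (Q P : Measure X)
    [IsProbabilityMeasure Q] [IsProbabilityMeasure P] {s : ℝ} (hs : 0 < s) (hs1 : s ≤ 1)
    (h : klDiv Q P ≤ ENNReal.ofReal (s ^ 2)) : tvMeas Q P ≤ 2 * s := by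
  obtain ⟨hQP, hint⟩ := klDiv_ne_top_iff.1 (h.trans_lt ofReal_lt_top).ne
  have hkl : ∫ x, klFun (Q.rnDeriv P x).toReal ∂P ≤ s ^ 2 := by
    rw [← toReal_klDiv_eq_integral_klFun hQP]
    exact ENNReal.toReal_le_of_le_ofReal (by positivity) h
  have hklint : Integrable (fun x => klFun (Q.rnDeriv P x).toReal) P :=
    (integrable_klFun_rnDeriv_iff hQP).2 hint
  have hf : Integrable (fun x => (Q.rnDeriv P x).toReal - 1) P :=
    Measure.integrable_toReal_rnDeriv.sub (integrable_const _)
  have hL1 : s * ∫ x, |(Q.rnDeriv P x).toReal - 1| ∂P ≤ s ^ 2 + s ^ 2 := by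
    rw [← integral_const_mul]
    calc ∫ x, s * |(Q.rnDeriv P x).toReal - 1| ∂P
        ≤ ∫ x, (klFun (Q.rnDeriv P x).toReal + s ^ 2) ∂P :=
          integral_mono (hf.abs.const_mul s) (hklint.add (integrable_const _)) fun x =>
            mul_abs_sub_one_le_klFun_add_sq toReal_nonneg hs.le hs1
      _ ≤ s ^ 2 + s ^ 2 := by
          rw [integral_add hklint (integrable_const _)]
          simpa using hkl
  have hL1' : ∫ x, |(Q.rnDeriv P x).toReal - 1| ∂P ≤ 2 * s := by nlinarith
  refine ciSup_le fun A => le_trans ?_ hL1'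
  have hA : (Q A).toReal - (P A).toReal = ∫ x in A, ((Q.rnDeriv P x).toReal - 1) ∂P := by
    rw [integral_sub Measure.integrable_toReal_rnDeriv.integrableOn (integrable_const _),
      Measure.setIntegral_toReal_rnDeriv hQP]
    simp [measureReal_def]
  rw [hA]
  exact abs_integral_le_integral_abs.trans
    (setIntegral_le_integral hf.abs (ae_of_all _ fun x => abs_nonneg _))

lemma tvMeas_nonneg {X : Type*} [MeasurableSpace X] (P Q : Measure X) : 0 ≤ tvMeas P Q :=
  Real.iSup_nonneg fun _ => abs_nonneg _

/-- Characterization of the global minimizers of the OKL function: if `ε > inf_θ D(P0, Pθ)`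
and the `D`-balls are convex and TV-closed, then `inf_θ I_ε(θ) = 0` and the set of zeros of
`I_ε` equals the set of identifiable parameters `{θ : D(P0, Pθ) ≤ ε}`. -/
theorem stmt18 {X : Type*} [MeasurableSpace X] [TopologicalSpace X] [PolishSpace X]
    [BorelSpace X] {Θ : Type*} [Nonempty Θ]
    (P : Θ → Measure X) (hP : ∀ θ, IsProbabilityMeasure (P θ))
    (P0 : Measure X) [IsProbabilityMeasure P0]
    (D : Measure X → Measure X → ℝ)
    (hDnonneg : ∀ Pm Q : Measure X, IsProbabilityMeasure Pm → IsProbabilityMeasure Q →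
      0 ≤ D Pm Q)
    (hDeq : ∀ Pm Q : Measure X, IsProbabilityMeasure Pm → IsProbabilityMeasure Q →
      (D Pm Q = 0 ↔ Pm = Q))
    (hDsymm : ∀ Pm Q : Measure X, IsProbabilityMeasure Pm → IsProbabilityMeasure Q →
      D Pm Q = D Q Pm)
    (hDtri : ∀ Pm Q R : Measure X, IsProbabilityMeasure Pm → IsProbabilityMeasure Q →
      IsProbabilityMeasure R → D Pm Q ≤ D Pm R + D R Q)
    (hballconv : ∀ Pm : Measure X, IsProbabilityMeasure Pm → ∀ ε' : ℝ, 0 < ε' →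
      ∀ Q1 Q2 : Measure X, IsProbabilityMeasure Q1 → IsProbabilityMeasure Q2 →
      D Q1 Pm ≤ ε' → D Q2 Pm ≤ ε' → ∀ t : ℝ, 0 ≤ t → t ≤ 1 →
      D (ENNReal.ofReal (1 - t) • Q1 + ENNReal.ofReal t • Q2) Pm ≤ ε')
    (hballclosed : ∀ Pm : Measure X, IsProbabilityMeasure Pm → ∀ ε' : ℝ, 0 < ε' →
      ∀ Qs : ℕ → Measure X, (∀ n, IsProbabilityMeasure (Qs n)) →
      (∀ n, D (Qs n) Pm ≤ ε') → ∀ Q : Measure X, IsProbabilityMeasure Q →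
      Tendsto (fun n => tvMeas (Qs n) Q) atTop (𝓝 0) → D Q Pm ≤ ε')
    (ε : ℝ) (hε : (⨅ θ : Θ, D P0 (P θ)) < ε) :
    (⨅ θ : Θ, OKLD D P0 (P θ) ε) = 0 ∧
    {θ : Θ | OKLD D P0 (P θ) ε = 0} = {θ : Θ | D P0 (P θ) ≤ ε} := by
  have hzero : ∀ θ, OKLD D P0 (P θ) ε = 0 ↔ D P0 (P θ) ≤ ε := by
    intro θ
    have := hP θ
    constructor
    · intro h
      have hεpos : 0 < ε :=
        (Real.iInf_nonneg fun θ => hDnonneg P0 (P θ) inferInstance (hP θ)).trans_lt hε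
      have hex : ∀ n : ℕ, ∃ Q : Measure X, IsProbabilityMeasure Q ∧ D Q P0 ≤ ε ∧
          KLdiv Q (P θ) ≤ ENNReal.ofReal ((1 / ((n : ℝ) + 1)) ^ 2) := by
        intro n
        have hlt : OKLD D P0 (P θ) ε < ENNReal.ofReal ((1 / ((n : ℝ) + 1)) ^ 2) := by
          rw [h, ENNReal.ofReal_pos]
          positivity
        simp only [OKLD, iInf_lt_iff] at hlt
        obtain ⟨Q, ⟨hQ, hQD⟩, hlt⟩ := hlt
        exact ⟨Q, hQ, hQD, hlt.le⟩
      choose Qs hQs hQD hQK using hex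
      rw [hDsymm _ _ inferInstance (hP θ)]
      refine hballclosed P0 inferInstance ε hεpos Qs hQs hQD (P θ) (hP θ) ?_
      have hlim : Tendsto (fun n : ℕ => 2 * (1 / ((n : ℝ) + 1))) atTop (𝓝 0) := by
        simpa using tendsto_one_div_add_atTop_nhds_zero_nat.const_mul (2 : ℝ)
      refine squeeze_zero (fun n => tvMeas_nonneg _ _) (fun n => ?_) hlim
      have := hQs n
      refine tvMeas_le_of_klDiv_le _ _ (by positivity) ?_ (KLdiv_eq_klDiv (Qs n) (P θ) ▸ hQK n)
      rw [div_le_one (by positivity)]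
      linarith [(Nat.cast_nonneg n : (0 : ℝ) ≤ n)]
    · intro h
      rw [hDsymm _ _ inferInstance (hP θ)] at h
      refine le_antisymm ((iInf₂_le (P θ) ⟨hP θ, h⟩).trans ?_) zero_le
      rw [KLdiv_eq_klDiv, InformationTheory.klDiv_self]
  refine ⟨?_, Set.ext hzero⟩
  obtain ⟨θ, hθ⟩ := exists_lt_of_ciInf_lt hε
  exact le_antisymm ((iInf_le _ θ).trans ((hzero θ).2 hθ.le).le) zero_le
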